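/- Let k be a solid assignment and suppose that dim 𝒫_k = #𝔹_k. Then 𝒥_k ⊕ 𝒫_k = Π, i.e., 𝒥_k ∩ 𝒫_k = {0} and 𝒥_k + 𝒫_k = Π; in particular 𝒫_k and 𝒟_k are dual to each other under the pairing ⟨·,·⟩. -/

import Mathlib

open MvPolynomial

noncomputable section

/-- The linear polynomial `p_x : t ↦ x ⬝ t`. -/
def pLin (n : ℕ) (x : Fin n → ℝ) : MvPolynomial (Fin n) ℝ :=
  ∑ i, MvPolynomial.C (x i) * MvPolynomial.X i

/-- `p_Z = ∏_{x ∈ Z} p_x` for a sub-multiset `Z` of the multiset indexed by `ι`. -/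
def pProd (n : ℕ) {ι : Type} (v : ι → Fin n → ℝ) (Z : Finset ι) : MvPolynomial (Fin n) ℝ :=
  ∏ a ∈ Z, pLin n (v a)

/-- `q_Z = ∏_{x ∈ Z} (p_x - λ_x)`. -/
def qProd (n : ℕ) {ι : Type} (v : ι → Fin n → ℝ) (lam : ι → ℝ) (Z : Finset ι) :
    MvPolynomial (Fin n) ℝ :=
  ∏ a ∈ Z, (pLin n (v a) - MvPolynomial.C (lam a))

/-- The pairing `⟨p,q⟩ = (p(∂)q)(0) = ∑_α α! p_α q_α`. -/
def pairing (n : ℕ) (p q : MvPolynomial (Fin n) ℝ) : ℝ :=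
  ∑ α ∈ p.support, p.coeff α * q.coeff α * (α.prod fun _ e => (Nat.factorial e : ℝ))

/-- `B` is a basis of the multiset: its vectors form a basis of `ℝ^n`. -/
def IsBasisSet (n : ℕ) {ι : Type} (v : ι → Fin n → ℝ) (B : Finset ι) : Prop :=
  LinearIndependent ℝ (fun b : B => v b) ∧ Submodule.span ℝ (v '' ↑B) = ⊤

/-- The ideal `𝒥_{𝔹'}` generated by the `p_Z` over all `Z` meeting every `B ∈ 𝔹'`. -/
def Jideal (n : ℕ) {ι : Type} [DecidableEq ι] (v : ι → Fin n → ℝ) (𝔹' : Set (Finset ι)) :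
    Ideal (MvPolynomial (Fin n) ℝ) :=
  Ideal.span {p | ∃ Z : Finset ι, (∀ B ∈ 𝔹', (Z ∩ B).Nonempty) ∧ p = pProd n v Z}

/-- The kernel space `𝒟_{𝔹'}`. -/
def Dspace (n : ℕ) {ι : Type} [DecidableEq ι] (v : ι → Fin n → ℝ) (𝔹' : Set (Finset ι)) :
    Submodule ℝ (MvPolynomial (Fin n) ℝ) where
  carrier := {f | ∀ g ∈ Jideal n v 𝔹', pairing n g f = 0}
  zero_mem' := by intro g _; simp [pairing]
  add_mem' := by
    intro a b ha hb g hg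
    have h : pairing n g (a + b) = pairing n g a + pairing n g b := by
      simp only [pairing, MvPolynomial.coeff_add]
      rw [← Finset.sum_add_distrib]
      exact Finset.sum_congr rfl fun α _ => by ring
    rw [h, ha g hg, hb g hg, add_zero]
  smul_mem' := by
    intro c f hf g hg
    have h : pairing n g (c • f) = c * pairing n g f := by
      simp only [pairing, MvPolynomial.coeff_smul, smul_eq_mul, Finset.mul_sum]
      exact Finset.sum_congr rfl fun α _ => by ring
    rw [h, hf g hg, mul_zero]

/-- A solid assignment `k : 2^X → ℕ`. -/
def Solid (n : ℕ) {ι : Type} (v : ι → Fin n → ℝ) (k : Finset ι → ℕ) : Prop :=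
  ∀ Z Z' : Finset ι,
    Submodule.span ℝ (v '' ↑Z) ≤ Submodule.span ℝ (v '' ↑Z') → k Z ≤ k Z'

/-- An incremental assignment. -/
def Incremental {ι : Type} [DecidableEq ι] (k : Finset ι → ℕ) : Prop :=
  ∀ (Z : Finset ι) (x : ι), k (insert x Z) ≤ k Z + 1

/-- `m(I) = k(I) + n - #I`. -/
def mVal (n : ℕ) {ι : Type} (k : Finset ι → ℕ) (I : Finset ι) : ℕ := k I + n - I.card

/-- `B ∩ X` for `B ⊆ X ∪ Y`. -/
def leftPart {ι : Type} [Fintype ι] [DecidableEq ι] {M : ℕ} (B : Finset (ι ⊕ Fin M)) :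
    Finset ι :=
  Finset.univ.filter fun i => Sum.inl i ∈ B

/-- `B ∩ Y` for `B ⊆ X ∪ Y`, as a set of indices in `Y`. -/
def rightPart {ι : Type} [Fintype ι] [DecidableEq ι] {M : ℕ} (B : Finset (ι ⊕ Fin M)) :
    Finset (Fin M) :=
  Finset.univ.filter fun j => Sum.inr j ∈ B

/-- `Y_i = {y_1, …, y_i}` as a set of indices. -/
def YFin {M : ℕ} (i : ℕ) : Finset (Fin M) := Finset.univ.filter fun j => (j : ℕ) < i

/-- `X ∪ Y_i` as a subset of the index set of `X ∪ Y`. -/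
def XYup (ι : Type) [Fintype ι] [DecidableEq ι] (M : ℕ) (i : ℕ) : Finset (ι ⊕ Fin M) :=
  Finset.univ.image Sum.inl ∪ (YFin (M := M) i).image Sum.inr

/-- `Y` is in general position in `X ∪ Y`: no `y ∈ Y` lies in the span of fewer than `n`
vectors of `(X ∪ Y) ∖ {y}`. -/
def GeneralPosition (n : ℕ) {ι : Type} [Fintype ι] [DecidableEq ι] {M : ℕ}
    (v : ι → Fin n → ℝ) (y : Fin M → Fin n → ℝ) : Prop :=
  ∀ (j : Fin M) (S : Finset (ι ⊕ Fin M)), Sum.inr j ∉ S → S.card < n →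
    y j ∉ Submodule.span ℝ (Sum.elim v y '' ↑S)

/-- `𝔹_k : the bases `B` of `X ∪ Y` with `B ∩ Y ⊆ Y_{m(B ∩ X)}`. -/
def Bk (n : ℕ) {ι : Type} [Fintype ι] [DecidableEq ι] (v : ι → Fin n → ℝ) {M : ℕ}
    (y : Fin M → Fin n → ℝ) (k : Finset ι → ℕ) : Set (Finset (ι ⊕ Fin M)) :=
  {B | IsBasisSet n (Sum.elim v y) B ∧
    ∀ j : Fin M, Sum.inr j ∈ B → (j : ℕ) < mVal n k (leftPart B)}

/-- The space `𝒫_k = ∑_{Z ⊆ X} p_{X∖Z} Π_{k(Z)}`. -/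
def Pspace (n : ℕ) {ι : Type} [Fintype ι] [DecidableEq ι] (v : ι → Fin n → ℝ)
    (k : Finset ι → ℕ) : Submodule ℝ (MvPolynomial (Fin n) ℝ) :=
  ⨆ Z : Finset ι,
    Submodule.map (LinearMap.mulLeft ℝ (pProd n v (Finset.univ \ Z)))
      (MvPolynomial.restrictTotalDegree (Fin n) ℝ (k Z))

/-- The constants `λ` are generic: each basis `B` determines a point `bp B` at which
`q_z` vanishes exactly when `z ∈ B`. -/
def Generic (n : ℕ) {ι : Type} (v : ι → Fin n → ℝ) (lam : ι → ℝ)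
    (bp : Finset ι → Fin n → ℝ) : Prop :=
  ∀ B : Finset ι, IsBasisSet n v B →
    ∀ z : ι, MvPolynomial.eval (bp B) (pLin n (v z) - MvPolynomial.C (lam z)) = 0 ↔ z ∈ B

/-- `x` is placable in `𝔹'`. -/
def Placable {ι : Type} [DecidableEq ι] (x : ι) (𝔹' : Set (Finset ι)) : Prop :=
  ∀ B ∈ 𝔹', ∃ a ∈ B, (insert x B).erase a ∈ 𝔹'

/-- `𝔹'` is placible. -/
inductive Placible {ι : Type} [DecidableEq ι] : Set (Finset ι) → Prop
  | singleton (B : Finset ι) : Placible {B}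
  | split (𝔹' : Set (Finset ι)) (x : ι) (hx : Placable x 𝔹')
      (hne1 : {B ∈ 𝔹' | x ∈ B}.Nonempty) (hne2 : {B ∈ 𝔹' | x ∉ B}.Nonempty)
      (hp1 : Placible {B ∈ 𝔹' | x ∈ B}) (hp2 : Placible {B ∈ 𝔹' | x ∉ B}) :
      Placible 𝔹'

/-- `X(I)` : the elements of `X ∖ I` not in the span of the earlier elements of `I`. -/
def XsetI (n : ℕ) {ι : Type} [Fintype ι] [DecidableEq ι] [LinearOrder ι]
    (v : ι → Fin n → ℝ) (I : Finset ι) : Finset ι := by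
  classical
  exact Finset.univ.filter fun x =>
    x ∉ I ∧ v x ∉ Submodule.span ℝ (v '' {b | b ∈ I ∧ b < x})

/-- `X'(B)` for `B ⊆ X ∪ Y`, with the order on `X ∪ Y` putting `X` (with its own order)
before `Y` (ordered as given). -/
def XprimeB (n : ℕ) {ι : Type} [Fintype ι] [DecidableEq ι] [LinearOrder ι] {M : ℕ}
    (v : ι → Fin n → ℝ) (y : Fin M → Fin n → ℝ) (B : Finset (ι ⊕ Fin M)) :
    Finset (ι ⊕ Fin M) := by
  classical
  exact Finset.univ.filter fun z =>
    z ∉ B ∧ Sum.elim v y z ∉ Submodule.span ℝ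
      (Sum.elim v y '' {b | b ∈ B ∧ Sum.Lex (· < ·) (· < ·) b z})

/-- The least space `Π(Θ)`. -/
def leastSpace (n : ℕ) (Θ : Finset (Fin n → ℝ)) : Submodule ℝ (MvPolynomial (Fin n) ℝ) :=
  Submodule.span ℝ
    {f | ∃ (c : (Fin n → ℝ) → ℝ) (J : ℕ),
      f = (Nat.factorial J : ℝ)⁻¹ • ∑ θ ∈ Θ, c θ • pLin n θ ^ J ∧ f ≠ 0 ∧
      ∀ j < J, ∑ θ ∈ Θ, c θ • pLin n θ ^ j = 0}

/-- The central space `𝒫(X)`, spanned by the `p_Z` over short `Z`. -/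
def centralP (n : ℕ) {ι : Type} [Fintype ι] [DecidableEq ι] (v : ι → Fin n → ℝ) :
    Submodule ℝ (MvPolynomial (Fin n) ℝ) :=
  Submodule.span ℝ
    {p | ∃ Z : Finset ι, Submodule.span ℝ (v '' ↑(Finset.univ \ Z)) = ⊤ ∧ p = pProd n v Z}

end

lemma pow_le_aux {R κ : Type} [CommRing R] [DecidableEq κ] (p : κ → R) (m L : Ideal R) (d : ℕ)
    (U : Finset κ)
    (hU : ∀ T ⊆ U, T.card = d → m ≤ L ⊔ Ideal.span (p '' (T : Set κ))) (K : ℕ)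
    (hK : K + d ≤ U.card) :
    m ^ (K + 1) ≤ L ⊔ Ideal.span {q | ∃ W ⊆ U, W.card = K + 1 ∧ q = ∏ u ∈ W, p u} := by
  induction K with
  | zero =>
    obtain ⟨T, hT, hc⟩ := Finset.exists_subset_card_eq (s := U) (n := d) (by omega)
    rw [zero_add, pow_one]
    refine (hU T hT hc).trans (sup_le_sup le_rfl (Ideal.span_mono ?_))
    rintro _ ⟨u, hu, rfl⟩
    exact ⟨{u}, by simpa using hT hu, by simp, by simp⟩
  | succ K ih =>
    rw [pow_succ, Ideal.mul_le]
    intro a ha b hb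
    have ha' := ih (by omega) ha
    set G := L ⊔ Ideal.span {q | ∃ W ⊆ U, W.card = K + 1 + 1 ∧ q = ∏ u ∈ W, p u} with hG
    have key : L ⊔ Ideal.span {q | ∃ W ⊆ U, W.card = K + 1 ∧ q = ∏ u ∈ W, p u} ≤
        Submodule.comap (LinearMap.mulLeft R b) G := by
      refine sup_le ?_ (Ideal.span_le.2 ?_)
      · intro l hl
        exact Ideal.mem_sup_left (L.mul_mem_left _ hl)
      · rintro _ ⟨W, hW, hc, rfl⟩
        obtain ⟨T, hT, hTc⟩ := Finset.exists_subset_card_eq (s := U \ W) (n := d)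
          (by rw [Finset.card_sdiff_of_subset hW]; omega)
        have h2 : L ⊔ Ideal.span (p '' (T : Set κ)) ≤
            Submodule.comap (LinearMap.mulLeft R (∏ u ∈ W, p u)) G := by
          refine sup_le ?_ (Ideal.span_le.2 ?_)
          · intro l hl
            exact Ideal.mem_sup_left (L.mul_mem_left _ hl)
          · rintro _ ⟨u, hu, rfl⟩
            have hu' := Finset.mem_sdiff.1 (hT hu)
            refine Ideal.mem_sup_right (Ideal.subset_span ⟨insert u W, ?_, ?_, ?_⟩)
            · exact Finset.insert_subset hu'.1 hW
            · rw [Finset.card_insert_of_notMem hu'.2, hc]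
            · rw [Finset.prod_insert hu'.2]; simp [mul_comm]
        have h3 := h2 (hU T (hT.trans Finset.sdiff_subset) hTc hb)
        have h4 : (∏ u ∈ W, p u) * b ∈ G := h3
        have : b * (∏ u ∈ W, p u) ∈ G := by rwa [mul_comm]
        exact this
    have h5 : b * a ∈ G := key ha'
    rwa [mul_comm]

lemma pLin_add' (n : ℕ) (x z : Fin n → ℝ) : pLin n (x + z) = pLin n x + pLin n z := by
  simp [pLin, add_mul, Finset.sum_add_distrib]

lemma pLin_smul' (n : ℕ) (c : ℝ) (x : Fin n → ℝ) :
    pLin n (c • x) = MvPolynomial.C c * pLin n x := by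
  simp [pLin, Finset.mul_sum, mul_assoc]

lemma pLin_zero' (n : ℕ) : pLin n 0 = 0 := by simp [pLin]

lemma pLin_single' (n : ℕ) (i : Fin n) : pLin n (Pi.single i 1) = MvPolynomial.X i := by
  rw [pLin, Finset.sum_eq_single i] <;> simp +contextual

lemma vars_le_of_span (n : ℕ) (S : Set (Fin n → ℝ)) (hS : Submodule.span ℝ S = ⊤)
    (G : Ideal (MvPolynomial (Fin n) ℝ)) (h : ∀ x ∈ S, pLin n x ∈ G) :
    idealOfVars (Fin n) ℝ ≤ G := by
  rw [idealOfVars, Ideal.span_le]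
  rintro _ ⟨i, rfl⟩
  have : ∀ x ∈ Submodule.span ℝ S, pLin n x ∈ G := by
    intro x hx
    induction hx using Submodule.span_induction with
    | mem x hx => exact h x hx
    | zero => rw [pLin_zero']; exact G.zero_mem
    | add x z _ _ h1 h2 => rw [pLin_add']; exact G.add_mem h1 h2
    | smul c x _ h1 => rw [pLin_smul']; exact G.mul_mem_left _ h1
  have h1 := this (Pi.single i 1) (by rw [hS]; trivial)
  rwa [pLin_single'] at h1

lemma gp_indep (n : ℕ) {ι : Type} [Fintype ι] [DecidableEq ι] {M : ℕ}
    (v : ι → Fin n → ℝ) (y : Fin M → Fin n → ℝ) (hgen : GeneralPosition n v y)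
    (I : Finset ι) (hI : LinearIndepOn ℝ v (I : Set ι)) (T : Finset (Fin M))
    (hc : I.card + T.card ≤ n) :
    LinearIndepOn ℝ (Sum.elim v y) (I.disjSum T : Set (ι ⊕ Fin M)) := by
  induction T using Finset.induction_on with
  | empty =>
    have h : ((I.disjSum (∅ : Finset (Fin M)) : Finset (ι ⊕ Fin M)) : Set (ι ⊕ Fin M))
        = Sum.inl '' (I : Set ι) := by ext x; simp
    rw [h]
    exact LinearIndepOn.image_of_comp Sum.inl (Sum.elim v y) (by simpa using hI)
  | insert a T ha ih =>
    rw [Finset.card_insert_of_notMem ha] at hc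
    have h : ((I.disjSum (insert a T) : Finset (ι ⊕ Fin M)) : Set (ι ⊕ Fin M))
        = insert (Sum.inr a) (I.disjSum T : Set (ι ⊕ Fin M)) := by
      ext x; rcases x with x | x <;> simp
    rw [h, linearIndepOn_insert (by simpa using ha)]
    refine ⟨ih (by omega), ?_⟩
    exact hgen a (I.disjSum T) (by simpa using ha) (by rw [Finset.card_disjSum]; omega)

lemma exists_basis_sub (n : ℕ) {ι : Type} (v : ι → Fin n → ℝ) (Z : Finset ι) :
    ∃ I ⊆ Z, LinearIndepOn ℝ v (I : Set ι) ∧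
      Submodule.span ℝ (v '' (I : Set ι)) = Submodule.span ℝ (v '' (Z : Set ι)) := by
  classical
  obtain ⟨b, hb, h1, h2, h3⟩ := exists_linearIndepOn_extension (K := ℝ) (v := v)
    (linearIndepOn_empty ℝ v) (Set.empty_subset (Z : Set ι))
  refine ⟨Z.filter (· ∈ b), Finset.filter_subset _ _, ?_⟩
  have e : ((Z.filter (· ∈ b) : Finset ι) : Set ι) = b := by
    ext x; simp; exact fun h => hb h
  rw [e]
  exact ⟨h3, le_antisymm (Submodule.span_mono (Set.image_mono hb)) (Submodule.span_le.2 h2)⟩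

lemma finrank_span_img (n : ℕ) {κ : Type} (w : κ → Fin n → ℝ) (B : Finset κ)
    (h : LinearIndepOn ℝ w (B : Set κ)) :
    Module.finrank ℝ (Submodule.span ℝ (w '' (B : Set κ))) = B.card := by
  have h1 := finrank_span_eq_card (R := ℝ) (b := fun b : (B : Set κ) => w b) h
  rw [Set.image_eq_range, h1]
  simp

lemma isBasis_card (n : ℕ) {κ : Type} (w : κ → Fin n → ℝ) (B : Finset κ)
    (h : IsBasisSet n w B) : B.card = n := by
  have h1 := finrank_span_img n w B h.1
  rw [h.2] at h1
  simpa using h1.symm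

lemma YFin_card_le {M : ℕ} (i : ℕ) : (YFin (M := M) i).card ≤ i := by
  have : (YFin (M := M) i).card ≤ (Finset.range i).card :=
    Finset.card_le_card_of_injOn (fun j => (j : ℕ)) (by intro j hj; simpa [YFin] using hj)
      (fun a _ b _ h => Fin.ext h)
  simpa using this

lemma YFin_card {M : ℕ} (i : ℕ) (hi : i ≤ M) : (YFin (M := M) i).card = i := by
  refine le_antisymm (YFin_card_le i) ?_
  have : (Finset.univ : Finset (Fin i)).card ≤ (YFin (M := M) i).card :=
    Finset.card_le_card_of_injOn (Fin.castLE hi) (by intro j _; simp [YFin])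
      (fun a _ b _ h => Fin.castLE_injective hi h)
  simpa using this

lemma pProd_disjSum (n : ℕ) {ι : Type} {M : ℕ} (v : ι → Fin n → ℝ) (y : Fin M → Fin n → ℝ)
    (A : Finset ι) (W : Finset (Fin M)) :
    pProd n (Sum.elim v y) (A.disjSum W) = pProd n v A * ∏ u ∈ W, pLin n (y u) := by
  simp [pProd, Finset.prod_disjSum]

lemma mem_J_aux (n : ℕ) {ι : Type} [Fintype ι] [DecidableEq ι]
    (v : ι → Fin n → ℝ) {M : ℕ} (y : Fin M → Fin n → ℝ)
    (k : Finset ι → ℕ) (hsolid : Solid n v k) (Z I : Finset ι)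
    (hI : LinearIndepOn ℝ v (I : Set ι))
    (hs : Submodule.span ℝ (v '' (I : Set ι)) = Submodule.span ℝ (v '' (Z : Set ι)))
    (hr : I.card < n) (W : Finset (Fin M)) (hW : W ⊆ YFin (k Z + (n - I.card)))
    (hWc : W.card = k Z + 1) :
    pProd n v (Finset.univ \ Z) * ∏ u ∈ W, pLin n (y u) ∈
      Jideal n (Sum.elim v y) (Bk n v y k) := by
  rw [← pProd_disjSum]
  refine Ideal.subset_span ⟨_, ?_, rfl⟩
  intro B hB
  by_contra hcon
  rw [Finset.not_nonempty_iff_eq_empty, ← Finset.disjoint_iff_inter_eq_empty,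
    Finset.disjoint_left] at hcon
  have hc := isBasis_card _ _ _ hB.1
  have hl : leftPart B ⊆ Z := by
    intro i hi
    by_contra hZ
    exact hcon (a := Sum.inl i) (by simp [hZ]) (by simpa [leftPart] using hi)
  have hd : Disjoint (rightPart B) W := by
    rw [Finset.disjoint_left]
    intro j hj hjW
    exact hcon (a := Sum.inr j) (by simp [hjW]) (by simpa [rightPart] using hj)
  have hBe : (leftPart B).disjSum (rightPart B) = B := by
    ext x; rcases x with x | x <;> simp [leftPart, rightPart]
  have hcard : (leftPart B).card + (rightPart B).card = n := by
    rw [← Finset.card_disjSum, hBe, hc]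
  have hli : LinearIndepOn ℝ v (leftPart B : Set ι) := by
    have h1 : LinearIndepOn ℝ (Sum.elim v y) (B : Set (ι ⊕ Fin M)) := hB.1.1
    have h2 : LinearIndepOn ℝ (Sum.elim v y) (Sum.inl '' (leftPart B : Set ι)) :=
      h1.mono (by rintro _ ⟨i, hi, rfl⟩; simpa [leftPart] using hi)
    exact h2.comp_of_image Sum.inl_injective.injOn
  have hsp : Submodule.span ℝ (v '' (leftPart B : Set ι)) ≤ Submodule.span ℝ (v '' (Z : Set ι)) :=
    Submodule.span_mono (Set.image_mono (by exact_mod_cast hl))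
  have hk := hsolid _ _ hsp
  have hle : (leftPart B).card ≤ I.card := by
    rw [← finrank_span_img n v _ hli, ← finrank_span_img n v _ hI, hs]
    exact Submodule.finrank_mono hsp
  have hR : rightPart B ∪ W ⊆
      YFin (max (mVal n k (leftPart B)) (k Z + (n - I.card))) := by
    intro j hj
    rcases Finset.mem_union.1 hj with hj | hj
    · have := hB.2 j (by simpa [rightPart] using hj)
      simp [YFin, this]
    · have := hW hj
      simp only [YFin, Finset.mem_filter, Finset.mem_univ, true_and] at this
      simp [YFin, this]
  have h1 := (Finset.card_le_card hR).trans (YFin_card_le _)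
  rw [Finset.card_union_of_disjoint hd, hWc] at h1
  unfold mVal at h1
  omega

lemma sup_eq_top' (n : ℕ) (ι : Type) [Fintype ι] [DecidableEq ι]
    (v : ι → Fin n → ℝ) (M : ℕ) (y : Fin M → Fin n → ℝ)
    (hgen : GeneralPosition n v y)
    (k : Finset ι → ℕ) (hsolid : Solid n v k)
    (hM : ∀ I : Finset ι, (LinearIndependent ℝ fun i : I => v i) → mVal n k I ≤ M) :
    (Jideal n (Sum.elim v y) (Bk n v y k)).restrictScalars ℝ ⊔ Pspace n v k = ⊤ := by
  set Q := (Jideal n (Sum.elim v y) (Bk n v y k)).restrictScalars ℝ ⊔ Pspace n v k with hQ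
  have main : ∀ Z : Finset ι, ∀ f, pProd n v (Finset.univ \ Z) * f ∈ Q := by
    intro Z
    induction Z using Finset.strongInduction with
    | H Z ih =>
    obtain ⟨I, hIZ, hI, hs⟩ := exists_basis_sub n v Z
    have hcI := finrank_span_img n v I hI
    have hIn : I.card ≤ n := by
      rw [← hcI]; simpa using Submodule.finrank_le (Submodule.span ℝ (v '' (I : Set ι)))
    have hkI : k I = k Z := le_antisymm (hsolid _ _ hs.le) (hsolid _ _ hs.ge)
    have hMI := hM I hI
    unfold mVal at hMI
    have hpow : ∀ f ∈ idealOfVars (Fin n) ℝ ^ (k Z + 1),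
        pProd n v (Finset.univ \ Z) * f ∈ Q := by
      have hU : ∀ T ⊆ YFin (M := M) (k Z + (n - I.card)), T.card = n - I.card →
          idealOfVars (Fin n) ℝ ≤ Ideal.span ((fun z => pLin n (v z)) '' (Z : Set ι)) ⊔
            Ideal.span ((fun u => pLin n (y u)) '' (T : Set (Fin M))) := by
        intro T _ hT
        have hli := gp_indep n v y hgen I hI T (by omega)
        have hr := finrank_span_img n _ _ hli
        rw [Finset.card_disjSum, hT] at hr
        refine vars_le_of_span n _ (Submodule.eq_top_of_finrank_eq (by rw [hr]; simp; omega)) _ ?_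
        rintro _ ⟨x, hx, rfl⟩
        rcases x with x | x
        · refine Ideal.mem_sup_left (Ideal.subset_span ⟨x, hIZ (by simpa using hx), rfl⟩)
        · refine Ideal.mem_sup_right (Ideal.subset_span ⟨x, by simpa using hx, rfl⟩)
      have hL : ∀ f ∈ Ideal.span ((fun z => pLin n (v z)) '' (Z : Set ι)),
          pProd n v (Finset.univ \ Z) * f ∈ Q := by
        intro f hf
        induction hf using Submodule.span_induction with
        | zero => simp
        | add a b _ _ h1 h2 => rw [mul_add]; exact Q.add_mem h1 h2
        | smul a b hb h1 =>
          clear h1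
          rw [smul_eq_mul]
          induction hb using Submodule.span_induction generalizing a with
          | zero => simp
          | add b c _ _ h1 h2 => rw [mul_add, mul_add]; exact Q.add_mem (h1 a) (h2 a)
          | smul c b _ h1 => rw [smul_eq_mul, ← mul_assoc a]; exact h1 _
          | mem b hb =>
            obtain ⟨z, hz, rfl⟩ := hb
            have h2 := ih (Z.erase z) (Finset.erase_ssubset hz) a
            have h3 : Finset.univ \ Z.erase z = insert z (Finset.univ \ Z) := by
              ext x; by_cases hx : x = z <;> simp [hx]
            rw [h3, pProd, Finset.prod_insert (by simpa using hz)] at h2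
            convert h2 using 1
            simp only [pProd]; ring
        | mem b hb =>
            obtain ⟨z, hz, rfl⟩ := hb
            have h2 := ih (Z.erase z) (Finset.erase_ssubset hz) 1
            have h3 : Finset.univ \ Z.erase z = insert z (Finset.univ \ Z) := by
              ext x; by_cases hx : x = z <;> simp [hx]
            rw [h3, pProd, Finset.prod_insert (by simpa using hz)] at h2
            convert h2 using 1
            simp only [pProd]; ring
      intro f hf
      rcases hIn.lt_or_eq with hlt | heq
      · have h1 := pow_le_aux (fun u => pLin n (y u)) (idealOfVars (Fin n) ℝ) _ (n - I.card)
          (YFin (M := M) (k Z + (n - I.card))) hU (k Z) (by rw [YFin_card _ (by omega)]) hf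
        obtain ⟨a, ha, b, hb, rfl⟩ := Submodule.mem_sup.1 h1
        rw [mul_add]
        refine Q.add_mem (hL a ha) (Submodule.mem_sup_left ?_)
        have : Ideal.span {q | ∃ W ⊆ YFin (M := M) (k Z + (n - I.card)),
            W.card = k Z + 1 ∧ q = ∏ u ∈ W, pLin n (y u)} ≤
            Submodule.comap (LinearMap.mulLeft (MvPolynomial (Fin n) ℝ)
              (pProd n v (Finset.univ \ Z))) (Jideal n (Sum.elim v y) (Bk n v y k)) := by
          refine Ideal.span_le.2 ?_
          rintro _ ⟨W, hW, hWc, rfl⟩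
          exact mem_J_aux n v y k hsolid Z I hI hs hlt W hW hWc
        exact this hb
      · have h1 := hU ∅ (by simp) (by simp [heq])
        simp only [Finset.coe_empty, Set.image_empty, Ideal.span_empty, sup_bot_eq] at h1
        exact hL f (h1 (Ideal.pow_le_self (by omega) hf))
    intro f
    refine MvPolynomial.induction_on' f ?_ ?_
    · intro d c
      by_cases hd : d.degree ≤ k Z
      · refine Submodule.mem_sup_right (Submodule.mem_iSup_of_mem Z ⟨monomial d c, ?_, rfl⟩)
        rw [SetLike.mem_coe, mem_restrictTotalDegree]
        exact (totalDegree_monomial_le d c).trans hd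
      · refine hpow _ ((mem_pow_idealOfVars_iff' _ _).2 ?_)
        intro x hx
        rw [coeff_monomial, if_neg]
        rintro rfl
        omega
    · intro p q hp hq
      rw [mul_add]; exact Q.add_mem hp hq
  rw [eq_top_iff]
  intro f _
  have := main Finset.univ f
  simpa [pProd] using this

lemma pLin_homog (n : ℕ) (x : Fin n → ℝ) : (pLin n x).IsHomogeneous 1 := by
  refine IsHomogeneous.sum _ _ _ fun i _ => ?_
  simpa using (isHomogeneous_C (Fin n) (x i)).mul (isHomogeneous_X ℝ i)

lemma pProd_homog (n : ℕ) {κ : Type} (w : κ → Fin n → ℝ) (Z : Finset κ) :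
    (pProd n w Z).IsHomogeneous Z.card := by
  have := IsHomogeneous.prod Z (fun a => pLin n (w a)) (fun _ => 1) (fun a _ => pLin_homog n (w a))
  simpa [pProd] using this

/-- polynomials of degree `< j`. -/
def Flt (n : ℕ) (j : ℕ) : Submodule ℝ (MvPolynomial (Fin n) ℝ) where
  carrier := {p | ∀ d : Fin n →₀ ℕ, j ≤ d.degree → p.coeff d = 0}
  zero_mem' := by intro d _; simp
  add_mem' := by intro a b ha hb d hd; simp [ha d hd, hb d hd]
  smul_mem' := by intro c a ha d hd; simp [ha d hd]

lemma mem_Flt {n j : ℕ} {p : MvPolynomial (Fin n) ℝ} :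
    p ∈ Flt n j ↔ ∀ d : Fin n →₀ ℕ, j ≤ d.degree → p.coeff d = 0 := Iff.rfl

lemma Flt_mono {n i j : ℕ} (h : i ≤ j) : Flt n i ≤ Flt n j :=
  fun _ hp d hd => hp d (h.trans hd)

lemma homog_mem_Flt {n i : ℕ} {p : MvPolynomial (Fin n) ℝ} (h : p.IsHomogeneous i) :
    p ∈ Flt n (i + 1) := fun d hd => h.coeff_eq_zero (by omega)

lemma Flt_mul {n a b : ℕ} {p q : MvPolynomial (Fin n) ℝ} (hp : p ∈ Flt n (a + 1))
    (hq : q ∈ Flt n b) : p * q ∈ Flt n (a + b) := by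
  intro d hd
  rw [coeff_mul]
  refine Finset.sum_eq_zero fun x hx => ?_
  have hx' := Finset.HasAntidiagonal.mem_antidiagonal.1 hx
  have : x.1.degree + x.2.degree = d.degree := by rw [← hx', map_add]
  by_cases h : a + 1 ≤ x.1.degree
  · rw [hp _ h, zero_mul]
  · rw [hq _ (by omega), mul_zero]

lemma pq_sub (n : ℕ) {κ : Type} [DecidableEq κ] (w : κ → Fin n → ℝ) (lam : κ → ℝ) (Z : Finset κ) :
    pProd n w Z - qProd n w lam Z ∈ Flt n Z.card := by
  induction Z using Finset.induction_on with
  | empty => simp [pProd, qProd]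
  | insert a Z ha ih =>
    have hq : qProd n w lam Z ∈ Flt n (Z.card + 1) := by
      have := (Flt n (Z.card + 1)).sub_mem (homog_mem_Flt (pProd_homog n w Z))
        (Flt_mono (Nat.le_succ _) ih)
      simpa using this
    have e : pProd n w (insert a Z) - qProd n w lam (insert a Z) =
        pLin n (w a) * (pProd n w Z - qProd n w lam Z) + lam a • qProd n w lam Z := by
      simp only [pProd, qProd, Finset.prod_insert ha, MvPolynomial.smul_eq_C_mul]; ring
    rw [e, Finset.card_insert_of_notMem ha]
    refine (Flt n _).add_mem ?_ ((Flt n _).smul_mem _ hq)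
    rw [add_comm Z.card 1]
    exact Flt_mul (homog_mem_Flt (pLin_homog n _)) ih

/-- components of elements of `J` are leading forms modulo `I`. -/
lemma J_comp (n : ℕ) {κ : Type} [DecidableEq κ] (w : κ → Fin n → ℝ) (lam : κ → ℝ)
    (𝔹 : Set (Finset κ)) (I : Ideal (MvPolynomial (Fin n) ℝ))
    (hI : ∀ Z : Finset κ, (∀ B ∈ 𝔹, (Z ∩ B).Nonempty) → qProd n w lam Z ∈ I)
    (g : MvPolynomial (Fin n) ℝ) (hg : g ∈ Jideal n w 𝔹) (j : ℕ) :
    homogeneousComponent j g ∈ I.restrictScalars ℝ ⊔ Flt n j := by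
  have key : ∀ Z : Finset κ, (∀ B ∈ 𝔹, (Z ∩ B).Nonempty) → ∀ f : MvPolynomial (Fin n) ℝ,
      homogeneousComponent j (f * pProd n w Z) ∈ I.restrictScalars ℝ ⊔ Flt n j := by
    intro Z hZ f
    rw [← sum_homogeneousComponent f, Finset.sum_mul, map_sum]
    refine Submodule.sum_mem _ fun i _ => ?_
    have hh := (homogeneousComponent_isHomogeneous i f).mul (pProd_homog n w Z)
    rw [homogeneousComponent_of_mem hh]
    split_ifs with h
    · subst h
      set h := homogeneousComponent i f
      have e : h * pProd n w Z = h * qProd n w lam Z + h * (pProd n w Z - qProd n w lam Z) := by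
        ring
      rw [e]
      exact Submodule.add_mem_sup (I.mul_mem_left _ (hI Z hZ))
        (Flt_mul (homog_mem_Flt (homogeneousComponent_isHomogeneous i f)) (pq_sub n w lam Z))
    · exact Submodule.zero_mem _
  unfold Jideal at hg
  rw [Ideal.span, ← Set.image_id {p | _}] at hg
  obtain ⟨l, hl, c, rfl⟩ := (Submodule.mem_span_image_iff_exists_fun _).1 hg
  rw [map_sum]
  refine Submodule.sum_mem _ fun x _ => ?_
  obtain ⟨Z, hZ, hx⟩ := hl x.2
  have := key Z hZ (c x)
  rw [← hx] at this
  simpa using this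

lemma P_comp (n : ℕ) {ι : Type} [Fintype ι] [DecidableEq ι] (v : ι → Fin n → ℝ)
    (k : Finset ι → ℕ) (p : MvPolynomial (Fin n) ℝ) (hp : p ∈ Pspace n v k) (j : ℕ) :
    homogeneousComponent j p ∈ Pspace n v k := by
  have : Pspace n v k ≤ (Pspace n v k).comap (homogeneousComponent j) := by
    conv_lhs => unfold Pspace
    refine iSup_le fun Z => ?_
    rintro _ ⟨f, hf, rfl⟩
    rw [SetLike.mem_coe, mem_restrictTotalDegree] at hf
    rw [Submodule.mem_comap, LinearMap.mulLeft_apply]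
    rw [← sum_homogeneousComponent f, Finset.mul_sum, map_sum]
    refine Submodule.sum_mem _ fun i hi => ?_
    have hh := (pProd_homog n v (Finset.univ \ Z)).mul (homogeneousComponent_isHomogeneous i f)
    rw [homogeneousComponent_of_mem hh]
    split_ifs with h
    · refine Submodule.mem_iSup_of_mem Z ⟨homogeneousComponent i f, ?_, rfl⟩
      rw [SetLike.mem_coe, mem_restrictTotalDegree]
      refine (homogeneousComponent_isHomogeneous i f).totalDegree_le.trans ?_
      have := Finset.mem_range.1 hi
      omega
    · exact Submodule.zero_mem _
  exact this hp

lemma final_aux (n : ℕ) (J I P : Submodule ℝ (MvPolynomial (Fin n) ℝ))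
    (hJ : ∀ g ∈ J, ∀ j, homogeneousComponent j g ∈ I ⊔ Flt n j)
    (hP : ∀ p ∈ P, ∀ j, homogeneousComponent j p ∈ P)
    (hJP : J ⊔ P = ⊤) :
    I ⊔ P = ⊤ ∧ (I ⊓ P = ⊥ → J ⊓ P = ⊥) := by
  have h1 : ∀ j, Flt n j ≤ I ⊔ (P ⊓ Flt n j) := by
    intro j
    induction j with
    | zero =>
      intro f hf
      have : f = 0 := by ext d; simpa using hf d (Nat.zero_le _)
      rw [this]; exact Submodule.zero_mem _
    | succ j ih =>
      have hmono : Flt n j ≤ I ⊔ (P ⊓ Flt n (j + 1)) :=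
        ih.trans (sup_le_sup le_rfl (inf_le_inf le_rfl (Flt_mono (Nat.le_succ j))))
      intro f hf
      have hlow : f - homogeneousComponent j f ∈ Flt n j := by
        intro d hd
        rw [coeff_sub, coeff_homogeneousComponent]
        split_ifs with h
        · simp
        · rw [hf d (by omega)]; simp
      have hcomp : homogeneousComponent j f ∈ I ⊔ (P ⊓ Flt n (j + 1)) := by
        have hf' : f ∈ J ⊔ P := by rw [hJP]; trivial
        obtain ⟨g, hg, p, hp, rfl⟩ := Submodule.mem_sup.1 hf'
        rw [map_add]
        refine Submodule.add_mem _ ?_ (Submodule.mem_sup_right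
          ⟨hP p hp j, homog_mem_Flt (homogeneousComponent_isHomogeneous j p)⟩)
        exact sup_le le_sup_left hmono (hJ g hg j)
      have := Submodule.add_mem _ (hmono hlow) hcomp
      simpa using this
  refine ⟨?_, ?_⟩
  · rw [eq_top_iff]
    intro f _
    have hf : f ∈ Flt n (f.totalDegree + 1) := by
      intro d hd
      apply coeff_eq_zero_of_totalDegree_lt
      have : d.degree = ∑ i ∈ d.support, d i := rfl
      omega
    have h4 : I ⊔ (P ⊓ Flt n (f.totalDegree + 1)) ≤ I ⊔ P := sup_le_sup le_rfl inf_le_left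
    exact h4 (h1 _ hf)
  · intro hIP
    rw [eq_bot_iff]
    rintro p ⟨hpJ, hpP⟩
    have h2 : ∀ j, homogeneousComponent j p = 0 := by
      intro j
      have h3 : I ⊔ Flt n j ≤ I ⊔ (P ⊓ Flt n j) := sup_le le_sup_left (h1 j)
      obtain ⟨a, ha, b, hb, hab⟩ := Submodule.mem_sup.1 (h3 (hJ p hpJ j))
      have ha' : a ∈ I ⊓ P := by
        refine ⟨ha, ?_⟩
        have : a = homogeneousComponent j p - b := by rw [← hab]; ring
        rw [this]; exact P.sub_mem (hP p hpP j) hb.1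
      rw [hIP, Submodule.mem_bot] at ha'
      rw [ha', zero_add] at hab
      ext d
      by_cases hd : d.degree = j
      · rw [← hab, hb.2 d hd.ge]; simp
      · rw [(homogeneousComponent_isHomogeneous j p).coeff_eq_zero hd]; simp
    rw [Submodule.mem_bot, ← sum_homogeneousComponent p]
    exact Finset.sum_eq_zero fun i _ => h2 i

lemma eval_pLin (n : ℕ) (x t : Fin n → ℝ) : MvPolynomial.eval t (pLin n x) = ∑ i, x i * t i := by
  simp [pLin]

/-- the `lam` for which the equations indexed by `S` are consistent. -/
def Kcons (n : ℕ) {κ : Type} (w : κ → Fin n → ℝ) (S : Finset κ) : Submodule ℝ (κ → ℝ) where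
  carrier := {lam | ∃ t : Fin n → ℝ, ∀ z ∈ S, ∑ i, w z i * t i = lam z}
  zero_mem' := ⟨0, by simp⟩
  add_mem' := by
    rintro a b ⟨s, hs⟩ ⟨t, ht⟩
    exact ⟨s + t, fun z hz => by simp [mul_add, Finset.sum_add_distrib, hs z hz, ht z hz]⟩
  smul_mem' := by
    rintro c a ⟨s, hs⟩
    refine ⟨c • s, fun z hz => ?_⟩
    simp only [Pi.smul_apply, smul_eq_mul, ← hs z hz, Finset.mul_sum]
    exact Finset.sum_congr rfl fun i _ => by ring

lemma exists_sol (n : ℕ) {κ : Type} (w : κ → Fin n → ℝ) (B : Finset κ) (hB : IsBasisSet n w B)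
    (lam : κ → ℝ) : ∃ t : Fin n → ℝ, ∀ z ∈ B, ∑ i, w z i * t i = lam z := by
  have hs : ⊤ ≤ Submodule.span ℝ (Set.range fun b : B => w b) := by
    rw [← hB.2, Set.image_eq_range]; exact le_rfl
  let b := Module.Basis.mk hB.1 hs
  let φ : (Fin n → ℝ) →ₗ[ℝ] ℝ := b.constr ℝ fun z : B => lam z
  refine ⟨fun i => φ (fun j => if i = j then 1 else 0), fun z hz => ?_⟩
  have h1 := LinearMap.pi_apply_eq_sum_univ φ (w z)
  have h2 : φ (w z) = lam z := by
    have : w z = b ⟨z, hz⟩ := by simp [b]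
    rw [this]
    exact b.constr_basis ℝ _ _
  rw [← h2, h1]
  rfl

lemma exists_generic (n : ℕ) {κ : Type} [Fintype κ] [DecidableEq κ] (w : κ → Fin n → ℝ) :
    ∃ (lam : κ → ℝ) (bp : Finset κ → Fin n → ℝ),
      (∀ B, IsBasisSet n w B → ∀ z ∈ B, ∑ i, w z i * bp B i = lam z) ∧
      (∀ B B', IsBasisSet n w B → IsBasisSet n w B' → bp B = bp B' → B = B') := by
  classical
  let T := {p : Finset κ × Finset κ // IsBasisSet n w p.1 ∧ IsBasisSet n w p.2 ∧ p.1 ≠ p.2}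
  have hex : ∃ lam : κ → ℝ, ∀ p : T, lam ∉ Kcons n w (p.1.1 ∪ p.1.2) := by
    by_contra! hcon
    obtain ⟨⟨⟨B, B'⟩, h1, h2, h3⟩, htop⟩ := Subspace.exists_eq_top_of_iUnion_eq_univ
      (p := fun p : T => Kcons n w (p.1.1 ∪ p.1.2))
      (Set.eq_univ_of_forall fun lam => Set.mem_iUnion.2 (hcon lam))
    dsimp only at h1 h2 h3 htop
    have hz : ∃ z ∈ B', z ∉ B := by
      by_contra! hsub
      exact h3 (Finset.eq_of_subset_of_card_le hsub
        (by rw [isBasis_card _ _ _ h1, isBasis_card _ _ _ h2])).symm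
    obtain ⟨z, hz', hzB⟩ := hz
    have hm : (Pi.single z 1 : κ → ℝ) ∈ Kcons n w (B ∪ B') := by rw [htop]; trivial
    obtain ⟨t, ht⟩ := hm
    have h0 : ∀ x ∈ Submodule.span ℝ (w '' (B : Set κ)), ∑ i, x i * t i = 0 := by
      intro x hx
      induction hx using Submodule.span_induction with
      | mem x hx =>
        obtain ⟨b, hb, rfl⟩ := hx
        rw [ht b (Finset.mem_union_left _ hb), Pi.single_eq_of_ne]
        rintro rfl; exact hzB hb
      | zero => simp
      | add x x' _ _ h h' => simp [add_mul, Finset.sum_add_distrib, h, h']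
      | smul c x _ h => simp [mul_assoc, ← Finset.mul_sum, h]
    have h4 := h0 (w z) (by rw [h1.2]; trivial)
    rw [ht z (Finset.mem_union_right _ hz')] at h4
    simp at h4
  obtain ⟨lam, hlam⟩ := hex
  have hch : ∀ B : Finset κ, ∃ t : Fin n → ℝ, IsBasisSet n w B →
      ∀ z ∈ B, ∑ i, w z i * t i = lam z := by
    intro B
    by_cases hB : IsBasisSet n w B
    · obtain ⟨t, ht⟩ := exists_sol n w B hB lam
      exact ⟨t, fun _ => ht⟩
    · exact ⟨0, fun h => absurd h hB⟩
  choose bp hbp using hch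
  refine ⟨lam, bp, hbp, ?_⟩
  intro B B' hB hB' he
  by_contra hne
  refine hlam ⟨(B, B'), hB, hB', hne⟩ ⟨bp B, fun z hz => ?_⟩
  rcases Finset.mem_union.1 hz with hz | hz
  · exact hbp B hB z hz
  · rw [he]; exact hbp B' hB' z hz

lemma interp (n : ℕ) {α : Type} [Fintype α] [DecidableEq α] (θ : α → Fin n → ℝ)
    (hθ : Function.Injective θ) (c : α → ℝ) :
    ∃ f : MvPolynomial (Fin n) ℝ, ∀ a, MvPolynomial.eval (θ a) f = c a := by
  let L : α → MvPolynomial (Fin n) ℝ := fun a =>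
    ∏ b ∈ Finset.univ.erase a, ∑ i, (X i - C (θ b i)) ^ 2
  have hL0 : ∀ a b, a ≠ b → eval (θ b) (L a) = 0 := by
    intro a b hab
    simp only [L, map_prod]
    exact Finset.prod_eq_zero (i := b) (by simp [hab.symm]) (by simp)
  have hL1 : ∀ a, eval (θ a) (L a) ≠ 0 := by
    intro a
    simp only [L, map_prod]
    refine Finset.prod_ne_zero_iff.2 fun b hb => ?_
    intro h
    simp only [map_sum, map_pow, map_sub, eval_X, eval_C] at h
    rw [Finset.sum_eq_zero_iff_of_nonneg (fun i _ => sq_nonneg _)] at h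
    have : a = b := hθ (funext fun i => by
      have := h i (Finset.mem_univ i)
      have := pow_eq_zero_iff (two_ne_zero) |>.1 this
      linarith)
    simp [this] at hb
  refine ⟨∑ a, C (c a / eval (θ a) (L a)) * L a, fun a => ?_⟩
  rw [map_sum, Finset.sum_eq_single a]
  · simp [hL1 a]
  · intro b _ hb
    simp [hL0 b a hb]
  · simp

/-- for a solid assignment with `dim 𝒫_k = #𝔹_k`, one has
`𝒥_k ⊕ 𝒫_k = Π`: `𝒥_k ∩ 𝒫_k = {0}` and `𝒥_k + 𝒫_k = Π`. -/
theorem statement14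
    (n : ℕ) (hn : 1 ≤ n) (ι : Type) [Fintype ι] [DecidableEq ι]
    (v : ι → Fin n → ℝ) (M : ℕ) (y : Fin M → Fin n → ℝ)
    (hspan : Submodule.span ℝ (Set.range (Sum.elim v y)) = ⊤)
    (hgen : GeneralPosition n v y)
    (k : Finset ι → ℕ) (hsolid : Solid n v k)
    (hM : ∀ I : Finset ι, (LinearIndependent ℝ fun i : I => v i) → mVal n k I ≤ M)
    (hdim : Module.rank ℝ (Pspace n v k) = ((Bk n v y k).ncard : Cardinal)) :
    ((Jideal n (Sum.elim v y) (Bk n v y k)).restrictScalars ℝ ⊓ Pspace n v k = ⊥) ∧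
    ((Jideal n (Sum.elim v y) (Bk n v y k)).restrictScalars ℝ ⊔ Pspace n v k = ⊤) := by
  classical
  have hsup := sup_eq_top' n ι v M y hgen k hsolid hM
  refine ⟨?_, hsup⟩
  obtain ⟨lam, bp, hbp, hinj⟩ := exists_generic n (Sum.elim v y)
  let α := {B // B ∈ Bk n v y k}
  let ev : MvPolynomial (Fin n) ℝ →ₗ[ℝ] (α → ℝ) :=
    LinearMap.pi fun B : α => (MvPolynomial.aeval (R := ℝ) (bp B.1)).toLinearMap
  let I : Ideal (MvPolynomial (Fin n) ℝ) :=
    ⨅ B : α, RingHom.ker (MvPolynomial.eval (bp B.1))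
  have hIker : ∀ f, f ∈ I ↔ ev f = 0 := by
    intro f
    simp only [I, Ideal.mem_iInf, RingHom.mem_ker]
    constructor
    · intro h; funext B; simpa [ev, MvPolynomial.aeval_eq_eval] using h B
    · intro h B
      have := congrFun h B
      simpa [ev, MvPolynomial.aeval_eq_eval] using this
  have hIq : ∀ Z : Finset (ι ⊕ Fin M), (∀ B ∈ Bk n v y k, (Z ∩ B).Nonempty) →
      qProd n (Sum.elim v y) lam Z ∈ I := by
    intro Z hZ
    simp only [I, Ideal.mem_iInf, RingHom.mem_ker]
    rintro ⟨B, hB⟩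
    obtain ⟨z, hz⟩ := hZ B hB
    rw [Finset.mem_inter] at hz
    rw [qProd, map_prod]
    refine Finset.prod_eq_zero hz.1 ?_
    rw [map_sub, eval_pLin, hbp B hB.1 z hz.2]
    simp
  obtain ⟨hIP, hfin⟩ := final_aux n _ (I.restrictScalars ℝ) (Pspace n v k)
    (fun g hg j => J_comp n (Sum.elim v y) lam _ I hIq g hg j)
    (fun p hp j => P_comp n v k p hp j) hsup
  refine hfin ?_
  have hfd : Module.Finite ℝ (Pspace n v k) := Module.finite_of_rank_eq_nat hdim
  have hfr : Module.finrank ℝ (Pspace n v k) = Module.finrank ℝ (α → ℝ) := by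
    rw [Module.finrank_eq_of_rank_eq hdim, Module.finrank_fintype_fun_eq_card,
      ← Nat.card_eq_fintype_card]
    rfl
  have hsurj : Function.Surjective (ev ∘ₗ (Pspace n v k).subtype) := by
    intro c
    obtain ⟨f, hf⟩ := interp n (fun B : α => bp B.1)
      (fun B B' h => Subtype.ext (hinj _ _ B.2.1 B'.2.1 h)) c
    have hf' : f ∈ I.restrictScalars ℝ ⊔ Pspace n v k := by rw [hIP]; trivial
    obtain ⟨a, ha, p, hp, rfl⟩ := Submodule.mem_sup.1 hf'
    refine ⟨⟨p, hp⟩, ?_⟩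
    have h1 : ev a = 0 := (hIker a).1 ha
    have h2 : ev (a + p) = c := by
      funext B; simpa [ev, MvPolynomial.aeval_eq_eval] using hf B
    rw [map_add, h1, zero_add] at h2
    exact h2
  have hinj' := (LinearMap.injective_iff_surjective_of_finrank_eq_finrank hfr).2 hsurj
  rw [eq_bot_iff]
  rintro p ⟨hpI, hpP⟩
  have h1 : ev p = 0 := (hIker p).1 hpI
  have h2 : (⟨p, hpP⟩ : Pspace n v k) = 0 := hinj' (by rw [map_zero]; exact h1)
  simpa using congrArg Subtype.val h2
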